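/- (Carlen–Lieb sharpened strong subadditivity) Let ρ_ABC be a density matrix on a tripartite finite-dimensional Hilbert space ℂ^{d_A} ⊗ ℂ^{d_B} ⊗ ℂ^{d_C}, with reduced states ρ_A, ρ_B, ρ_AB obtained by partial trace. Then the conditional mutual information satisfies I(A:B|C) ≥ 2·max{ S(ρ_A) − S(ρ_AB), S(ρ_B) − S(ρ_AB), 0 }. -/

import Mathlib

open scoped Kronecker ComplexOrder

/-- Von Neumann entropy (natural logarithm) of a matrix, via its eigenvalues
(`0` if the matrix is not Hermitian; `Real.log 0 = 0` handles zero eigenvalues). -/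
noncomputable def vN {n : Type*} [Fintype n] [DecidableEq n] (ρ : Matrix n n ℂ) : ℝ :=
  if h : ρ.IsHermitian then -∑ i, h.eigenvalues i * Real.log (h.eigenvalues i) else 0

/-- Partial trace over the second tensor factor. -/
noncomputable def ptraceB {A B : Type*} [Fintype B] (ρ : Matrix (A × B) (A × B) ℂ) :
    Matrix A A ℂ := Matrix.of fun a a' => ∑ b, ρ (a, b) (a', b)

/-- Partial trace over the first tensor factor. -/
noncomputable def ptraceA {A B : Type*} [Fintype A] (ρ : Matrix (A × B) (A × B) ℂ) :
    Matrix B B ℂ := Matrix.of fun b b' => ∑ a, ρ (a, b) (a, b')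

/-- Partial trace over the third factor of a tripartite system `A × B × C`. -/
noncomputable def ptraceC3 {A B C : Type*} [Fintype C] (ρ : Matrix (A × B × C) (A × B × C) ℂ) :
    Matrix (A × B) (A × B) ℂ := Matrix.of fun x y => ∑ c, ρ (x.1, x.2, c) (y.1, y.2, c)

/-- Partial trace over the second factor of a tripartite system `A × B × C`. -/
noncomputable def ptraceB3 {A B C : Type*} [Fintype B] (ρ : Matrix (A × B × C) (A × B × C) ℂ) :
    Matrix (A × C) (A × C) ℂ := Matrix.of fun x y => ∑ b, ρ (x.1, b, x.2) (y.1, b, y.2)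

/-- Conditional mutual information `I(A:B|C) = S(ρ_AC) + S(ρ_BC) − S(ρ_ABC) − S(ρ_C)`. -/
noncomputable def condMutualInfo {A B C : Type*} [Fintype A] [DecidableEq A] [Fintype B]
    [DecidableEq B] [Fintype C] [DecidableEq C]
    (ρ : Matrix (A × B × C) (A × B × C) ℂ) : ℝ :=
  vN (ptraceB3 ρ) + vN (ptraceA ρ) - vN ρ - vN (ptraceA (ptraceA ρ))

open Matrix Filter Topology

section SpectralDecomposition

variable {n m : Type*} [Fintype n] [DecidableEq n] [Fintype m] [DecidableEq m]

/-- `U` is unitary and `ρ = U diag(p) Uᴴ` with real eigenvalues `p`. -/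
structure SpectralDecomp (ρ U : Matrix n n ℂ) (p : n → ℝ) : Prop where
  unitary : Uᴴ * U = 1
  eq : ρ = U * diagonal (fun i => (p i : ℂ)) * Uᴴ

theorem Matrix.IsHermitian.spectralDecomp {ρ : Matrix n n ℂ} (h : ρ.IsHermitian) :
    SpectralDecomp ρ h.eigenvectorUnitary h.eigenvalues where
  unitary := Unitary.coe_star_mul_self h.eigenvectorUnitary
  eq := h.spectral_theorem

namespace SpectralDecomp

variable {ρ U : Matrix n n ℂ} {p : n → ℝ}

theorem unitary' (h : SpectralDecomp ρ U p) : U * Uᴴ = 1 :=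
  mul_eq_one_comm.mp h.unitary

theorem isHermitian (h : SpectralDecomp ρ U p) : ρ.IsHermitian := by
  rw [h.eq]
  refine isHermitian_mul_mul_conjTranspose U ?_
  rw [IsHermitian, diagonal_conjTranspose]
  congr 1
  ext i
  simp

theorem submatrix (h : SpectralDecomp ρ U p) (e : m ≃ n) :
    SpectralDecomp (ρ.submatrix e e) (U.submatrix e e) (p ∘ e) where
  unitary := by
    rw [conjTranspose_submatrix, submatrix_mul_equiv, h.unitary, submatrix_one_equiv]
  eq := by
    have hd : diagonal (fun i => ((p ∘ e) i : ℂ)) =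
        (diagonal (fun i => (p i : ℂ))).submatrix e e := by
      rw [submatrix_diagonal_equiv]; rfl
    rw [hd, conjTranspose_submatrix, submatrix_mul_equiv, submatrix_mul_equiv, ← h.eq]

theorem one_kronecker (h : SpectralDecomp ρ U p) :
    SpectralDecomp ((1 : Matrix m m ℂ) ⊗ₖ ρ) ((1 : Matrix m m ℂ) ⊗ₖ U) (fun x => p x.2) where
  unitary := by
    rw [conjTranspose_kronecker, ← mul_kronecker_mul, h.unitary]
    simp
  eq := by
    have hd : diagonal (fun x : m × n => (p x.2 : ℂ)) =
        (1 : Matrix m m ℂ) ⊗ₖ diagonal (fun i => (p i : ℂ)) := by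
      rw [← diagonal_one, diagonal_kronecker_diagonal]; simp
    rw [hd, conjTranspose_kronecker, ← mul_kronecker_mul, ← mul_kronecker_mul, ← h.eq]
    simp

theorem add_smul_one (h : SpectralDecomp ρ U p) (c : ℝ) :
    SpectralDecomp (ρ + (c : ℂ) • 1) U (fun i => p i + c) where
  unitary := h.unitary
  eq := by
    have hd : diagonal (fun i => ((p i + c : ℝ) : ℂ)) =
        diagonal (fun i => (p i : ℂ)) + (c : ℂ) • 1 := by
      rw [smul_one_eq_diagonal, diagonal_add]; simp
    rw [hd, mul_add, add_mul, ← h.eq]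
    simp [h.unitary']

theorem charpoly_roots (h : SpectralDecomp ρ U p) :
    ρ.charpoly.roots = Finset.univ.val.map (fun i => (p i : ℂ)) := by
  have : ρ.charpoly = ∏ i, (Polynomial.X - Polynomial.C (p i : ℂ)) := by
    rw [h.eq, charpoly_mul_comm, ← mul_assoc, h.unitary, one_mul, charpoly_diagonal]
  rw [this, Polynomial.roots_prod]
  · simp
  · simp [Finset.prod_ne_zero_iff, Polynomial.X_sub_C_ne_zero]

end SpectralDecomp

end SpectralDecomposition

section Entropy

variable {n m : Type*} [Fintype n] [DecidableEq n] [Fintype m] [DecidableEq m]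

theorem vN_eq_roots_sum {ρ : Matrix n n ℂ} (h : ρ.IsHermitian) :
    vN ρ = (ρ.charpoly.roots.map fun z => Real.negMulLog z.re).sum := by
  rw [vN, dif_pos h, h.spectralDecomp.charpoly_roots, Multiset.map_map]
  simp [Real.negMulLog]

theorem SpectralDecomp.vN_eq {ρ U : Matrix n n ℂ} {p : n → ℝ} (h : SpectralDecomp ρ U p) :
    vN ρ = ∑ i, Real.negMulLog (p i) := by
  rw [vN_eq_roots_sum h.isHermitian, h.charpoly_roots, Multiset.map_map]
  simp

theorem vN_submatrix_equiv {ρ : Matrix n n ℂ} (h : ρ.IsHermitian) (e : m ≃ n) :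
    vN (ρ.submatrix e e) = vN ρ := by
  rw [(h.spectralDecomp.submatrix e).vN_eq, h.spectralDecomp.vN_eq]
  exact Equiv.sum_comp e fun i => Real.negMulLog (h.eigenvalues i)

theorem vN_transpose {ρ : Matrix n n ℂ} (h : ρ.IsHermitian) : vN ρᵀ = vN ρ := by
  rw [vN_eq_roots_sum h, vN_eq_roots_sum h.transpose, charpoly_transpose]

/-- `M Mᴴ` and `Mᴴ M` have the same nonzero spectrum, hence the same entropy. -/
theorem vN_mul_conjTranspose_comm (M : Matrix m n ℂ) : vN (M * Mᴴ) = vN (Mᴴ * M) := by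
  rw [vN_eq_roots_sum (isHermitian_mul_conjTranspose_self M),
    vN_eq_roots_sum (isHermitian_conjTranspose_mul_self M)]
  have h := congrArg (fun P => (P.roots.map fun z : ℂ => Real.negMulLog z.re).sum)
    (charpoly_mul_comm' M Mᴴ)
  have hX : ∀ (k : ℕ) (P : Polynomial ℂ), P.Monic →
      ((Polynomial.X ^ k * P).roots.map fun z : ℂ => Real.negMulLog z.re).sum =
        (P.roots.map fun z : ℂ => Real.negMulLog z.re).sum := by
    intro k P hP
    rw [Polynomial.roots_mul (mul_ne_zero (pow_ne_zero _ Polynomial.X_ne_zero) hP.ne_zero),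
      Polynomial.roots_X_pow]
    simp [Multiset.map_nsmul, Multiset.sum_nsmul]
  simpa only [hX _ _ (charpoly_monic _)] using h

theorem tendsto_vN_add_smul_one {ρ : Matrix n n ℂ} (h : ρ.IsHermitian) (k : ℝ) :
    Tendsto (fun ε : ℝ => vN (ρ + ((ε * k : ℝ) : ℂ) • 1)) (𝓝[>] 0) (𝓝 (vN ρ)) := by
  simp_rw [(h.spectralDecomp.add_smul_one _).vN_eq]
  rw [h.spectralDecomp.vN_eq]
  have hc : Continuous fun ε : ℝ => ∑ i, Real.negMulLog (h.eigenvalues i + ε * k) := by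
    fun_prop
  simpa using (hc.tendsto 0).mono_left nhdsWithin_le_nhds

end Entropy

section RelativeEntropy

variable {n : Type*} [Fintype n] {ρ σ U V : Matrix n n ℂ} {p q : n → ℝ}

/-- The part of the integral representation of relative entropy coming from `[0, T]`. -/
noncomputable def truncRelEntropy (U V : Matrix n n ℂ) (p q : n → ℝ) (T : ℝ) : ℝ :=
  ∑ j, ∑ i, Complex.normSq ((Vᴴ * U) j i) * (p i * (Real.log (q j + T * p i) - Real.log (q j)))

theorem hasDerivAt_truncRelEntropy (U V : Matrix n n ℂ) (hp : ∀ i, 0 < p i) (hq : ∀ i, 0 < q i)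
    {t : ℝ} (ht : 0 ≤ t) :
    HasDerivAt (truncRelEntropy U V p q)
      (∑ j, ∑ i, Complex.normSq ((Vᴴ * U) j i) * (p i * (p i / (q j + t * p i)))) t := by
  unfold truncRelEntropy
  refine HasDerivAt.fun_sum fun j _ => HasDerivAt.fun_sum fun i _ => ?_
  have hs : q j + t * p i ≠ 0 := by have := hp i; have := hq j; positivity
  have h : HasDerivAt (fun T => q j + T * p i) (p i) t := by
    simpa using ((hasDerivAt_id t).mul_const (p i)).const_add (q j)
  exact (((h.log hs).sub_const _).const_mul _).const_mul _

/-- The concave quadratic functional of `w` whose maximum is `Tr[ρ (L_σ + t R_ρ)⁻¹ ρ]`,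
where `L_σ` and `R_ρ` are left multiplication by `σ` and right multiplication by `ρ`. -/
noncomputable def resolventForm (ρ σ : Matrix n n ℂ) (t : ℝ) (w : Matrix n n ℂ) : ℝ :=
  2 * (trace (wᴴ * ρ)).re - (trace (w * wᴴ * σ)).re - t * (trace (wᴴ * w * ρ)).re

variable [DecidableEq n]

theorem resolventForm_conj (hρ : SpectralDecomp ρ U p) (hσ : SpectralDecomp σ V q) (t : ℝ)
    (W : Matrix n n ℂ) :
    resolventForm ρ σ t (V * W * Uᴴ) = ∑ j, ∑ i,
      (2 * (star (W j i) * (Vᴴ * U) j i).re * p i - Complex.normSq (W j i) * (q j + t * p i)) := by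
  have h1 : trace ((V * W * Uᴴ)ᴴ * ρ) =
      trace (Wᴴ * ((Vᴴ * U) * diagonal (fun i => (p i : ℂ)))) := by
    rw [hρ.eq]
    simp only [conjTranspose_mul, conjTranspose_conjTranspose, mul_assoc]
    rw [trace_mul_comm]
    simp only [mul_assoc, hρ.unitary, mul_one]
  have h2 : trace ((V * W * Uᴴ) * (V * W * Uᴴ)ᴴ * σ) =
      trace (Wᴴ * (diagonal (fun i => (q i : ℂ)) * W)) := by
    have e : (V * W * Uᴴ) * (V * W * Uᴴ)ᴴ * σ =
        V * W * (Uᴴ * U) * Wᴴ * (Vᴴ * V) * diagonal (fun i => (q i : ℂ)) * Vᴴ := by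
      rw [hσ.eq]
      simp only [conjTranspose_mul, conjTranspose_conjTranspose, mul_assoc]
    rw [e, hρ.unitary, hσ.unitary, trace_mul_comm]
    simp only [mul_one, ← mul_assoc, hσ.unitary, one_mul]
    rw [mul_assoc, trace_mul_comm]
  have h3 : trace ((V * W * Uᴴ)ᴴ * (V * W * Uᴴ) * ρ) =
      trace (Wᴴ * (W * diagonal (fun i => (p i : ℂ)))) := by
    have e : (V * W * Uᴴ)ᴴ * (V * W * Uᴴ) * ρ =
        U * Wᴴ * (Vᴴ * V) * W * (Uᴴ * U) * diagonal (fun i => (p i : ℂ)) * Uᴴ := by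
      rw [hρ.eq]
      simp only [conjTranspose_mul, conjTranspose_conjTranspose, mul_assoc]
    rw [e, hρ.unitary, hσ.unitary, trace_mul_comm]
    simp only [mul_one, ← mul_assoc, hρ.unitary, one_mul]
  have key : ∀ X : Matrix n n ℂ, (trace (Wᴴ * X)).re =
      ∑ j, ∑ i, (star (W j i) * X j i).re := by
    intro X
    simp only [trace, diag, mul_apply, conjTranspose_apply, Complex.re_sum]
    exact Finset.sum_comm
  rw [resolventForm, h1, h2, h3, key, key, key]
  simp only [Finset.mul_sum, ← Finset.sum_sub_distrib]
  refine Finset.sum_congr rfl fun j _ => Finset.sum_congr rfl fun i _ => ?_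
  simp only [mul_diagonal, diagonal_mul]
  simp [Complex.normSq_apply]
  ring

theorem resolventForm_le (hρ : SpectralDecomp ρ U p) (hσ : SpectralDecomp σ V q)
    (hp : ∀ i, 0 < p i) (hq : ∀ i, 0 < q i) {t : ℝ} (ht : 0 ≤ t) (w : Matrix n n ℂ) :
    resolventForm ρ σ t w ≤
      ∑ j, ∑ i, Complex.normSq ((Vᴴ * U) j i) * (p i * (p i / (q j + t * p i))) := by
  have hw : w = V * (Vᴴ * w * U) * Uᴴ := by
    simp only [← mul_assoc, hσ.unitary', one_mul]
    rw [mul_assoc, hρ.unitary', mul_one]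
  rw [hw, resolventForm_conj hρ hσ]
  refine Finset.sum_le_sum fun j _ => Finset.sum_le_sum fun i _ => ?_
  have hs : 0 < q j + t * p i := by have := hp i; have := hq j; positivity
  generalize (Vᴴ * w * U) j i = z
  generalize (Vᴴ * U) j i = M
  rw [← mul_div_assoc, ← mul_div_assoc, le_div_iff₀ hs]
  simp only [Complex.normSq_apply, Complex.star_def, Complex.mul_re, Complex.conj_re,
    Complex.conj_im]
  nlinarith [sq_nonneg (z.re * (q j + t * p i) - M.re * p i),
    sq_nonneg (z.im * (q j + t * p i) - M.im * p i)]

theorem exists_resolventForm_eq (hρ : SpectralDecomp ρ U p) (hσ : SpectralDecomp σ V q)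
    (hp : ∀ i, 0 < p i) (hq : ∀ i, 0 < q i) {t : ℝ} (ht : 0 ≤ t) :
    ∃ w, resolventForm ρ σ t w =
      ∑ j, ∑ i, Complex.normSq ((Vᴴ * U) j i) * (p i * (p i / (q j + t * p i))) := by
  refine ⟨V * (of fun j i => (Vᴴ * U) j i * ((p i / (q j + t * p i) : ℝ) : ℂ)) * Uᴴ, ?_⟩
  rw [resolventForm_conj hρ hσ]
  refine Finset.sum_congr rfl fun j _ => Finset.sum_congr rfl fun i _ => ?_
  have hs : 0 < q j + t * p i := by have := hp i; have := hq j; positivity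
  have hx : p i / (q j + t * p i) * (q j + t * p i) = p i := div_mul_cancel₀ _ hs.ne'
  rw [of_apply]
  generalize (Vᴴ * U) j i = M
  generalize p i / (q j + t * p i) = x at *
  simp only [Complex.normSq_apply, Complex.star_def, Complex.mul_re, Complex.mul_im,
    Complex.conj_re, Complex.conj_im, Complex.ofReal_re, Complex.ofReal_im]
  linear_combination (-(M.re * M.re + M.im * M.im) * x) * hx

theorem sum_normSq_conjTranspose_mul (hU : Uᴴ * U = 1) (hV : V * Vᴴ = 1) (i : n) :
    ∑ j, Complex.normSq ((Vᴴ * U) j i) = 1 := by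
  have h : (Vᴴ * U)ᴴ * (Vᴴ * U) = 1 := by
    rw [conjTranspose_mul, conjTranspose_conjTranspose, mul_assoc, ← mul_assoc V, hV, one_mul, hU]
  have := congrFun (congrFun h i) i
  rw [mul_apply, one_apply_eq] at this
  have := congrArg Complex.re this
  simpa [Complex.normSq_apply] using this

/-- The logarithm of `σ` read off from a spectral decomposition. -/
noncomputable def spectralLog (V : Matrix n n ℂ) (q : n → ℝ) : Matrix n n ℂ :=
  V * diagonal (fun i => (Real.log (q i) : ℂ)) * Vᴴ

theorem trace_mul_spectralLog (hρ : SpectralDecomp ρ U p) (V : Matrix n n ℂ) (q : n → ℝ) :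
    (trace (ρ * spectralLog V q)).re =
      ∑ j, ∑ i, Complex.normSq ((Vᴴ * U) j i) * (p i * Real.log (q j)) := by
  have e : trace (ρ * spectralLog V q) = trace ((Vᴴ * U * diagonal (fun i => (p i : ℂ))) *
      ((Vᴴ * U)ᴴ * diagonal (fun i => (Real.log (q i) : ℂ)))) := by
    rw [hρ.eq, spectralLog, ← mul_assoc, trace_mul_comm]
    simp only [conjTranspose_mul, conjTranspose_conjTranspose, mul_assoc]
  rw [e]
  generalize Vᴴ * U = M
  simp only [trace, diag, Matrix.mul_apply (M := M * diagonal _), Complex.re_sum, mul_diagonal,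
    conjTranspose_apply]
  refine Finset.sum_congr rfl fun j _ => Finset.sum_congr rfl fun i _ => ?_
  simp [Complex.normSq_apply]
  ring

theorem tendsto_truncRelEntropy (hρ : SpectralDecomp ρ U p) (hσ : SpectralDecomp σ V q)
    (hp : ∀ i, 0 < p i) :
    Tendsto (fun T => truncRelEntropy U V p q T - (trace ρ).re * Real.log T) atTop
      (𝓝 (-vN ρ - (trace (ρ * spectralLog V q)).re)) := by
  have htr : (trace ρ).re = ∑ j, ∑ i, Complex.normSq ((Vᴴ * U) j i) * p i := by
    rw [Finset.sum_comm]
    simp_rw [← Finset.sum_mul, sum_normSq_conjTranspose_mul hρ.unitary hσ.unitary', one_mul]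
    rw [hρ.eq, trace_mul_comm, ← mul_assoc, hρ.unitary, one_mul]
    simp [trace_diagonal]
  have hS : -vN ρ = ∑ j, ∑ i, Complex.normSq ((Vᴴ * U) j i) * (p i * Real.log (p i)) := by
    rw [Finset.sum_comm]
    simp_rw [← Finset.sum_mul, sum_normSq_conjTranspose_mul hρ.unitary hσ.unitary', one_mul]
    rw [hρ.vN_eq]
    simp [Real.negMulLog]
  rw [hS, trace_mul_spectralLog hρ, htr]
  simp only [truncRelEntropy, Finset.sum_mul, ← Finset.sum_sub_distrib]
  refine tendsto_finsetSum _ fun j _ => tendsto_finsetSum _ fun i _ => ?_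
  have hlim : Tendsto (fun T : ℝ => Real.log (q j * T⁻¹ + p i)) atTop (𝓝 (Real.log (p i))) := by
    refine Tendsto.log ?_ (hp i).ne'
    simpa using (tendsto_inv_atTop_zero.const_mul (q j)).add_const (p i)
  have hlim' : Tendsto (fun T : ℝ => Complex.normSq ((Vᴴ * U) j i) *
      (p i * (Real.log (q j * T⁻¹ + p i) - Real.log (q j)))) atTop
      (𝓝 (Complex.normSq ((Vᴴ * U) j i) * (p i * (Real.log (p i) - Real.log (q j))))) :=
    ((hlim.sub_const _).const_mul _).const_mul _
  rw [← mul_sub, ← mul_sub]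
  refine hlim'.congr' ?_
  have hpos : ∀ᶠ T : ℝ in atTop, 0 < q j * T⁻¹ + p i :=
    (show Tendsto (fun T : ℝ => q j * T⁻¹ + p i) atTop (𝓝 (p i)) by
      simpa using (tendsto_inv_atTop_zero.const_mul (q j)).add_const (p i)).eventually
        (lt_mem_nhds (hp i))
  filter_upwards [hpos, eventually_gt_atTop 0] with T hT hT0
  have : q j + T * p i = T * (q j * T⁻¹ + p i) := by field_simp
  rw [this, Real.log_mul hT0.ne' hT.ne']
  ring

end RelativeEntropy

section PartialTrace

variable {A B : Type*} [Fintype A] [Fintype B]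

theorem trace_kronecker_one_mul [DecidableEq B] (X : Matrix A A ℂ) (ρ : Matrix (A × B) (A × B) ℂ) :
    trace ((X ⊗ₖ (1 : Matrix B B ℂ)) * ρ) = trace (X * ptraceB ρ) := by
  simp only [trace, diag, mul_apply, Fintype.sum_prod_type, kronecker_apply, ptraceB, of_apply,
    one_apply, mul_ite, mul_one, mul_zero, ite_mul, zero_mul, Finset.sum_ite_eq, Finset.mem_univ,
    if_true, Finset.mul_sum]
  exact Finset.sum_congr rfl fun a _ => Finset.sum_comm

theorem trace_one_kronecker_mul [DecidableEq A] (X : Matrix B B ℂ) (ρ : Matrix (A × B) (A × B) ℂ) :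
    trace (((1 : Matrix A A ℂ) ⊗ₖ X) * ρ) = trace (X * ptraceA ρ) := by
  simp only [trace, diag, mul_apply, Fintype.sum_prod_type_right, kronecker_apply, ptraceA,
    of_apply, one_apply, ite_mul, one_mul, zero_mul, Finset.sum_ite_eq, Finset.mem_univ,
    if_true, Finset.mul_sum]
  exact Finset.sum_congr rfl fun a _ => Finset.sum_comm

theorem resolventForm_kronecker_one [DecidableEq B] (ρ σ : Matrix (A × B) (A × B) ℂ) (t : ℝ)
    (w : Matrix A A ℂ) :
    resolventForm ρ σ t (w ⊗ₖ (1 : Matrix B B ℂ)) =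
      resolventForm (ptraceB ρ) (ptraceB σ) t w := by
  simp only [resolventForm, conjTranspose_kronecker, ← mul_kronecker_mul, conjTranspose_one,
    mul_one, trace_kronecker_one_mul]

/-- Monotonicity of relative entropy under partial trace. -/
theorem relEntropy_ptraceB_le [DecidableEq A] [DecidableEq B]
    {ρ σ U V : Matrix (A × B) (A × B) ℂ} {p q : A × B → ℝ}
    {U' V' : Matrix A A ℂ} {p' q' : A → ℝ}
    (hρ : SpectralDecomp ρ U p) (hσ : SpectralDecomp σ V q)
    (hρ' : SpectralDecomp (ptraceB ρ) U' p') (hσ' : SpectralDecomp (ptraceB σ) V' q')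
    (hp : ∀ i, 0 < p i) (hq : ∀ i, 0 < q i) (hp' : ∀ i, 0 < p' i) (hq' : ∀ i, 0 < q' i) :
    -vN (ptraceB ρ) - (trace (ptraceB ρ * spectralLog V' q')).re ≤
      -vN ρ - (trace (ρ * spectralLog V q)).re := by
  have htr : trace (ptraceB ρ) = trace ρ := by
    simpa using (trace_kronecker_one_mul (1 : Matrix A A ℂ) ρ).symm
  refine le_of_tendsto_of_tendsto (tendsto_truncRelEntropy hρ' hσ' hp')
    (tendsto_truncRelEntropy hρ hσ hp) ?_
  filter_upwards [eventually_ge_atTop 0] with T hT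
  rw [htr]
  refine sub_le_sub_right ?_ _
  have hd : ∀ t, 0 ≤ t → HasDerivAt
      (fun T => truncRelEntropy U V p q T - truncRelEntropy U' V' p' q' T) _ t := fun t ht =>
    (hasDerivAt_truncRelEntropy U V hp hq ht).sub (hasDerivAt_truncRelEntropy U' V' hp' hq' ht)
  have hmono : MonotoneOn
      (fun T => truncRelEntropy U V p q T - truncRelEntropy U' V' p' q' T) (Set.Ici 0) := by
    refine monotoneOn_of_hasDerivWithinAt_nonneg (convex_Ici 0)
      (fun t ht => (hd t ht).continuousAt.continuousWithinAt)
      (fun t ht => (hd t (interior_subset ht)).hasDerivWithinAt) fun t ht => ?_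
    have ht0 : 0 ≤ t := by simpa using interior_subset ht
    obtain ⟨w, hw⟩ := exists_resolventForm_eq hρ' hσ' hp' hq' ht0
    rw [sub_nonneg, ← hw, ← resolventForm_kronecker_one]
    exact resolventForm_le hρ hσ hp hq ht0 _
  have h0 := hmono (Set.self_mem_Ici) (Set.mem_Ici.mpr hT) hT
  simp only [truncRelEntropy, zero_mul, add_zero, sub_self, mul_zero,
    Finset.sum_const_zero] at h0
  exact sub_nonneg.mp h0

end PartialTrace

section StrongSubadditivity

variable {A B C : Type*}

theorem ptraceA_eq_sum [Fintype A] (ρ : Matrix (A × B) (A × B) ℂ) :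
    ptraceA ρ = ∑ a, ρ.submatrix (Prod.mk a) (Prod.mk a) := by
  ext b b'
  simp [ptraceA, Matrix.sum_apply]

theorem ptraceB_eq_sum [Fintype B] (ρ : Matrix (A × B) (A × B) ℂ) :
    ptraceB ρ = ∑ b, ρ.submatrix (fun a => (a, b)) (fun a => (a, b)) := by
  ext b b'
  simp [ptraceB, Matrix.sum_apply]

/-- The rearrangement of `A × B × C` that moves the middle factor last. -/
def middleLast (A B C : Type*) : (A × C) × B ≃ A × B × C where
  toFun x := (x.1.1, x.2, x.1.2)
  invFun x := ((x.1, x.2.2), x.2.1)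

theorem ptraceB3_eq_ptraceB [Fintype B] (ρ : Matrix (A × B × C) (A × B × C) ℂ) :
    ptraceB3 ρ = ptraceB (ρ.submatrix (middleLast A B C) (middleLast A B C)) := rfl

theorem ptraceC3_eq_ptraceB [Fintype C] (ρ : Matrix (A × B × C) (A × B × C) ℂ) :
    ptraceC3 ρ = ptraceB (ρ.submatrix (Equiv.prodAssoc A B C) (Equiv.prodAssoc A B C)) := rfl

theorem ptraceA_add_smul_one [Fintype A] [DecidableEq A] [DecidableEq B]
    (ρ : Matrix (A × B) (A × B) ℂ) (c : ℂ) :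
    ptraceA (ρ + c • 1) = ptraceA ρ + (c * Fintype.card A) • 1 := by
  ext b b'
  by_cases h : b = b' <;>
    simp [ptraceA, one_apply, Finset.sum_add_distrib, h, mul_comm]

theorem ptraceB_add_smul_one [Fintype B] [DecidableEq A] [DecidableEq B]
    (ρ : Matrix (A × B) (A × B) ℂ) (c : ℂ) :
    ptraceB (ρ + c • 1) = ptraceB ρ + (c * Fintype.card B) • 1 := by
  ext b b'
  by_cases h : b = b' <;>
    simp [ptraceB, one_apply, Finset.sum_add_distrib, h, mul_comm]

protected theorem Matrix.PosSemidef.ptraceA [Fintype A]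
    {ρ : Matrix (A × B) (A × B) ℂ} (h : ρ.PosSemidef) :
    (ptraceA ρ).PosSemidef := by
  rw [ptraceA_eq_sum]
  exact posSemidef_sum _ fun a _ => h.submatrix _

protected theorem Matrix.PosSemidef.ptraceB [Fintype B]
    {ρ : Matrix (A × B) (A × B) ℂ} (h : ρ.PosSemidef) :
    (ptraceB ρ).PosSemidef := by
  rw [ptraceB_eq_sum]
  exact posSemidef_sum _ fun a _ => h.submatrix _

protected theorem Matrix.PosDef.ptraceA [Fintype A] [Nonempty A]
    {ρ : Matrix (A × B) (A × B) ℂ} (h : ρ.PosDef) :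
    (ptraceA ρ).PosDef := by
  rw [ptraceA_eq_sum]
  exact posDef_sum Finset.univ_nonempty fun a _ => h.submatrix (Prod.mk_right_injective a)

protected theorem Matrix.PosDef.ptraceB [Fintype B] [Nonempty B]
    {ρ : Matrix (A × B) (A × B) ℂ} (h : ρ.PosDef) :
    (ptraceB ρ).PosDef := by
  rw [ptraceB_eq_sum]
  exact posDef_sum Finset.univ_nonempty fun b _ => h.submatrix (Prod.mk_left_injective b)

protected theorem Matrix.PosSemidef.ptraceB3 [Fintype B]
    {ρ : Matrix (A × B × C) (A × B × C) ℂ} (h : ρ.PosSemidef) :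
    (ptraceB3 ρ).PosSemidef :=
  ptraceB3_eq_ptraceB ρ ▸ (h.submatrix _).ptraceB

protected theorem Matrix.PosSemidef.ptraceC3 [Fintype C]
    {ρ : Matrix (A × B × C) (A × B × C) ℂ} (h : ρ.PosSemidef) :
    (ptraceC3 ρ).PosSemidef :=
  ptraceC3_eq_ptraceB ρ ▸ (h.submatrix _).ptraceB

theorem ptraceB3_add_smul_one [DecidableEq A] [Fintype B] [DecidableEq B] [DecidableEq C]
    (ρ : Matrix (A × B × C) (A × B × C) ℂ) (c : ℂ) :
    ptraceB3 (ρ + c • 1) = ptraceB3 ρ + (c * Fintype.card B) • 1 := by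
  rw [ptraceB3_eq_ptraceB, ptraceB3_eq_ptraceB, ← ptraceB_add_smul_one]
  congr 1
  rw [submatrix_add, Pi.add_apply, Pi.add_apply, submatrix_smul, Pi.smul_apply, Pi.smul_apply,
    submatrix_one_equiv]

variable [Fintype A] [DecidableEq A] [Fintype B] [DecidableEq B] [Fintype C] [DecidableEq C]

theorem spectralLog_submatrix {n m : Type*} [Fintype n] [DecidableEq n] [Fintype m]
    [DecidableEq m] (V : Matrix n n ℂ) (q : n → ℝ) (e : m ≃ n) :
    spectralLog (V.submatrix e e) (q ∘ e) = (spectralLog V q).submatrix e e := by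
  have hd : diagonal (fun i => (Real.log ((q ∘ e) i) : ℂ)) =
      (diagonal (fun i => (Real.log (q i) : ℂ))).submatrix e e := by
    rw [submatrix_diagonal_equiv]; rfl
  rw [spectralLog, hd, conjTranspose_submatrix, submatrix_mul_equiv, submatrix_mul_equiv,
    spectralLog]

theorem spectralLog_one_kronecker (V : Matrix B B ℂ) (q : B → ℝ) :
    spectralLog ((1 : Matrix A A ℂ) ⊗ₖ V) (fun x => q x.2) =
      (1 : Matrix A A ℂ) ⊗ₖ spectralLog V q := by
  have hd : diagonal (fun x : A × B => (Real.log (q x.2) : ℂ)) =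
      (1 : Matrix A A ℂ) ⊗ₖ diagonal (fun i => (Real.log (q i) : ℂ)) := by
    rw [← diagonal_one, diagonal_kronecker_diagonal]; simp
  rw [spectralLog, hd, conjTranspose_kronecker, ← mul_kronecker_mul, ← mul_kronecker_mul]
  simp [spectralLog]

theorem SpectralDecomp.trace_mul_spectralLog_self {n : Type*} [Fintype n] [DecidableEq n]
    {ρ U : Matrix n n ℂ} {p : n → ℝ} (h : SpectralDecomp ρ U p) :
    (trace (ρ * spectralLog U p)).re = -vN ρ := by
  have e : ρ * spectralLog U p =
      U * (diagonal (fun i => (p i : ℂ)) * ((Uᴴ * U) *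
        diagonal (fun i => (Real.log (p i) : ℂ)))) * Uᴴ := by
    conv_lhs => rw [h.eq]
    simp only [spectralLog, mul_assoc]
  rw [e, trace_mul_comm, ← mul_assoc, h.unitary, one_mul, one_mul, diagonal_mul_diagonal,
    trace_diagonal, h.vN_eq, Complex.re_sum]
  simp [Real.negMulLog]

theorem trace_mul_spectralLog_one_kronecker {ρ : Matrix (A × B) (A × B) ℂ} {V : Matrix B B ℂ}
    {q : B → ℝ} (h : SpectralDecomp (ptraceA ρ) V q) :
    (trace (ρ * spectralLog ((1 : Matrix A A ℂ) ⊗ₖ V) (fun x => q x.2))).re =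
      -vN (ptraceA ρ) := by
  rw [spectralLog_one_kronecker, trace_mul_comm, trace_one_kronecker_mul, trace_mul_comm,
    h.trace_mul_spectralLog_self]

/-- Strong subadditivity for positive definite matrices. -/
theorem Matrix.PosDef.condMutualInfo_nonneg [Nonempty A] [Nonempty B]
    {ρ : Matrix (A × B × C) (A × B × C) ℂ} (h : ρ.PosDef) : 0 ≤ condMutualInfo ρ := by
  let e := middleLast A B C
  have hAC : (ptraceB (ρ.submatrix e e)).PosDef := (h.submatrix e.injective).ptraceB
  have hBC := h.ptraceA
  have hC := hBC.ptraceA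
  have hAC_C : ptraceA (ptraceB (ρ.submatrix e e)) =
      ptraceA (ptraceA ρ) := by
    ext c c'
    exact Finset.sum_comm
  have hσ := (hBC.isHermitian.spectralDecomp.one_kronecker (m := A)).submatrix e
  have hσ' := hC.isHermitian.spectralDecomp.one_kronecker (m := A)
  have hred : ptraceB (((1 : Matrix A A ℂ) ⊗ₖ ptraceA ρ).submatrix e e) =
      (1 : Matrix A A ℂ) ⊗ₖ ptraceA (ptraceA ρ) := by
    ext x y
    simp [ptraceB, ptraceA, e, middleLast, Finset.mul_sum]
  rw [← hred] at hσ'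
  have key := relEntropy_ptraceB_le (h.isHermitian.spectralDecomp.submatrix e) hσ
    hAC.isHermitian.spectralDecomp hσ'
    (fun i => h.eigenvalues_pos _) (fun i => hBC.eigenvalues_pos _)
    (fun i => hAC.eigenvalues_pos _) (fun i => hC.eigenvalues_pos _)
  have hdec := hC.isHermitian.spectralDecomp
  generalize hC.isHermitian.eigenvalues = q at hdec key
  generalize (hC.isHermitian.eigenvectorUnitary : Matrix C C ℂ) = V at hdec key
  rw [← hAC_C] at hdec
  have htrace : ∀ X : Matrix (A × B × C) (A × B × C) ℂ, trace (X.submatrix e e) = trace X :=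
    fun X => Equiv.sum_comp e fun i => X i i
  rw [trace_mul_spectralLog_one_kronecker hdec, hAC_C, spectralLog_submatrix, submatrix_mul_equiv,
    htrace, trace_mul_spectralLog_one_kronecker hBC.isHermitian.spectralDecomp,
    vN_submatrix_equiv h.isHermitian, ← ptraceB3_eq_ptraceB] at key
  rw [condMutualInfo]
  linarith

/-- Strong subadditivity of the von Neumann entropy. -/
theorem Matrix.PosSemidef.condMutualInfo_nonneg [Nonempty A] [Nonempty B]
    {ρ : Matrix (A × B × C) (A × B × C) ℂ} (h : ρ.PosSemidef) : 0 ≤ condMutualInfo ρ := by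
  have hlim := (((tendsto_vN_add_smul_one h.ptraceB3.isHermitian (Fintype.card B)).add
    (tendsto_vN_add_smul_one h.ptraceA.isHermitian (Fintype.card A))).sub
    (tendsto_vN_add_smul_one h.isHermitian 1)).sub
    (tendsto_vN_add_smul_one h.ptraceA.ptraceA.isHermitian (Fintype.card A * Fintype.card B))
  refine ge_of_tendsto hlim ?_
  filter_upwards [self_mem_nhdsWithin] with ε hε
  have hpos : (ρ + (ε : ℂ) • 1).PosDef :=
    PosDef.posSemidef_add h (PosDef.one.smul (by exact_mod_cast hε))
  have := hpos.condMutualInfo_nonneg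
  rw [condMutualInfo, ptraceB3_add_smul_one, ptraceA_add_smul_one, ptraceA_add_smul_one] at this
  push_cast
  simpa only [mul_one, mul_assoc] using this

open scoped MatrixOrder in
theorem Matrix.PosSemidef.exists_eq_mul_conjTranspose {n : Type*} [Fintype n]
    {ρ : Matrix n n ℂ} (h : ρ.PosSemidef) : ∃ M : Matrix n n ℂ, ρ = M * Mᴴ := by
  classical
  obtain ⟨M, hM⟩ := CStarAlgebra.nonneg_iff_eq_star_mul_self.mp h.nonneg
  exact ⟨Mᴴ, by rw [conjTranspose_conjTranspose]; exact hM⟩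

/-- Strong subadditivity applied to a purification:
`S(ρ_A) + S(ρ_C) ≤ S(ρ_AB) + S(ρ_BC)`. -/
theorem Matrix.PosSemidef.vN_add_vN_le [Nonempty A] [Nonempty B] [Nonempty C]
    {ρ : Matrix (A × B × C) (A × B × C) ℂ} (h : ρ.PosSemidef) :
    vN (ptraceB ρ) + vN (ptraceA (ptraceA ρ)) ≤
      vN (ptraceC3 ρ) + vN (ptraceA ρ) := by
  obtain ⟨M, hM⟩ := h.exists_eq_mul_conjTranspose
  let N : Matrix (B × (A × B × C) × A) C ℂ := of fun x c => M (x.2.2, x.1, c) x.2.1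
  let K : Matrix ((A × B × C) × A) (B × C) ℂ := of fun x y => M (x.2, y.1, y.2) x.1
  have hssa := (posSemidef_self_mul_conjTranspose N).condMutualInfo_nonneg
  have hAB : ptraceB3 (N * Nᴴ) =
      (ptraceC3 ρ).submatrix (Equiv.prodComm B A) (Equiv.prodComm B A) := by
    ext x y
    simp only [ptraceB3, ptraceC3, hM, of_apply, submatrix_apply, mul_apply,
      conjTranspose_apply, N]
    exact Finset.sum_comm
  have hAD : ptraceA (N * Nᴴ) = K * Kᴴ := by
    ext x y
    simp only [ptraceA, of_apply, mul_apply, conjTranspose_apply, N, K,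
      Fintype.sum_prod_type (α₁ := B)]
  have hBC : Kᴴ * K = (ptraceA ρ)ᵀ := by
    ext x y
    simp only [ptraceA, hM, of_apply, mul_apply, conjTranspose_apply, transpose_apply, K]
    rw [Fintype.sum_prod_type_right]
    simp only [mul_comm]
  have hC : Nᴴ * N = (ptraceA (ptraceA ρ))ᵀ := by
    ext x y
    simp only [ptraceA, hM, of_apply, mul_apply, conjTranspose_apply, transpose_apply, N]
    rw [Fintype.sum_prod_type]
    refine Finset.sum_congr rfl fun b _ => ?_
    rw [Fintype.sum_prod_type_right]
    simp only [mul_comm]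
  have hA : ptraceA (ptraceA (N * Nᴴ)) = ptraceB ρ := by
    ext x y
    simp only [ptraceA, ptraceB, hM, of_apply, mul_apply, conjTranspose_apply, N]
    rw [Fintype.sum_prod_type (α₁ := B), Finset.sum_comm]
    refine Finset.sum_congr rfl fun b _ => Finset.sum_comm
  rw [condMutualInfo, hA, hAB, hAD, vN_mul_conjTranspose_comm, vN_mul_conjTranspose_comm, hBC, hC,
    vN_transpose h.ptraceA.isHermitian, vN_transpose h.ptraceA.ptraceA.isHermitian,
    vN_submatrix_equiv h.ptraceC3.isHermitian] at hssa
  linarith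

/-- `S(ρ_ABC) + S(ρ_A) ≤ S(ρ_AB) + S(ρ_AC)`. -/
theorem Matrix.PosSemidef.vN_add_vN_ptraceB_le [Nonempty B] [Nonempty C]
    {ρ : Matrix (A × B × C) (A × B × C) ℂ} (h : ρ.PosSemidef) :
    vN ρ + vN (ptraceB ρ) ≤ vN (ptraceC3 ρ) + vN (ptraceB3 ρ) := by
  let e : B × C × A ≃ A × B × C := (Equiv.prodAssoc B C A).symm.trans (Equiv.prodComm _ _)
  have hssa := (h.submatrix e).condMutualInfo_nonneg
  have hAB : ptraceB3 (ρ.submatrix e e) =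
    (ptraceC3 ρ).submatrix (Equiv.prodComm B A) (Equiv.prodComm B A) := rfl
  have hAC : ptraceA (ρ.submatrix e e) =
    (ptraceB3 ρ).submatrix (Equiv.prodComm C A) (Equiv.prodComm C A) := rfl
  have hA : ptraceA (ptraceA (ρ.submatrix e e)) = ptraceB ρ := by
    ext x y
    exact (Fintype.sum_prod_type_right fun z : B × C => ρ (x, z) (y, z)).symm
  rw [condMutualInfo, hA, hAB, hAC, vN_submatrix_equiv h.isHermitian,
    vN_submatrix_equiv h.ptraceC3.isHermitian, vN_submatrix_equiv h.ptraceB3.isHermitian] at hssa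
  linarith

theorem Matrix.PosSemidef.two_mul_vN_sub_le_condMutualInfo [Nonempty A] [Nonempty B] [Nonempty C]
    {ρ : Matrix (A × B × C) (A × B × C) ℂ} (h : ρ.PosSemidef) :
    2 * (vN (ptraceB ρ) - vN (ptraceC3 ρ)) ≤ condMutualInfo ρ := by
  have h₁ := h.vN_add_vN_le
  have h₂ := h.vN_add_vN_ptraceB_le
  rw [condMutualInfo]
  linarith

theorem Matrix.PosSemidef.two_mul_vN_sub_le_condMutualInfo' [Nonempty A] [Nonempty B] [Nonempty C]
    {ρ : Matrix (A × B × C) (A × B × C) ℂ} (h : ρ.PosSemidef) :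
    2 * (vN (ptraceB (ptraceA ρ)) - vN (ptraceC3 ρ)) ≤ condMutualInfo ρ := by
  let e : B × A × C ≃ A × B × C :=
    ((Equiv.prodAssoc B A C).symm.trans ((Equiv.prodComm B A).prodCongr (Equiv.refl C))).trans
      (Equiv.prodAssoc A B C)
  have key := (h.submatrix e).two_mul_vN_sub_le_condMutualInfo
  have hAC : ptraceA (ρ.submatrix e e) = ptraceB3 ρ := rfl
  have hBC : ptraceB3 (ρ.submatrix e e) = ptraceA ρ := rfl
  have hC : ptraceA (ptraceB3 ρ) = ptraceA (ptraceA ρ) := by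
    ext x y
    exact Finset.sum_comm
  have hAB : ptraceC3 (ρ.submatrix e e) =
    (ptraceC3 ρ).submatrix (Equiv.prodComm B A) (Equiv.prodComm B A) := rfl
  have hB : ptraceB (ρ.submatrix e e) = ptraceB (ptraceA ρ) := by
    ext x y
    exact Fintype.sum_prod_type_right fun z : A × C => ρ (z.1, x, z.2) (z.1, y, z.2)
  rw [condMutualInfo, hAC, hBC, hC, hAB, hB, vN_submatrix_equiv h.isHermitian,
    vN_submatrix_equiv h.ptraceC3.isHermitian] at key
  rw [condMutualInfo]
  linarith

end StrongSubadditivity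

/-- Carlen–Lieb sharpened strong subadditivity: for any tripartite
density matrix `ρ_ABC`, `I(A:B|C) ≥ 2·max{S(ρ_A) − S(ρ_AB), S(ρ_B) − S(ρ_AB), 0}`. -/
theorem carlen_lieb_strong_subadditivity
    (dA dB dC : ℕ)
    (ρ : Matrix (Fin dA × Fin dB × Fin dC) (Fin dA × Fin dB × Fin dC) ℂ)
    (hρ : ρ.PosSemidef) (htr : ρ.trace = 1) :
    condMutualInfo ρ ≥
      2 * max (max (vN (ptraceB ρ) - vN (ptraceC3 ρ))
                   (vN (ptraceB (ptraceA ρ)) - vN (ptraceC3 ρ))) 0 := by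
  have hne : Nonempty (Fin dA × Fin dB × Fin dC) := by
    by_contra hempty
    rw [not_nonempty_iff] at hempty
    simp [Matrix.trace] at htr
  obtain ⟨⟨a, b, c⟩⟩ := hne
  have : Nonempty (Fin dA) := ⟨a⟩
  have : Nonempty (Fin dB) := ⟨b⟩
  have : Nonempty (Fin dC) := ⟨c⟩
  rw [ge_iff_le, mul_max_of_nonneg _ _ zero_le_two, mul_max_of_nonneg _ _ zero_le_two, mul_zero]
  exact max_le (max_le hρ.two_mul_vN_sub_le_condMutualInfo hρ.two_mul_vN_sub_le_condMutualInfo')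
    hρ.condMutualInfo_nonneg
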